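/- arXiv:0904.3110 — 2 statements merged into one kernel-verified Lean document; each statement's English description precedes it below -/
import Mathlib

section
/- There exists a lattice Λ in ℝ^n possessing a Minkowskian sublattice Λ' with Λ/Λ' cyclic of order 4 if and only if n ≥ 7. -/
open scoped BigOperators RealInnerProductSpace

noncomputable section

/-- The minimum of a lattice `Λ` in `ℝⁿ`: the infimum of the squared Euclidean
lengths `N(x) = ⟪x, x⟫` of the nonzero vectors of `Λ`. -/
def latticeMin {n : ℕ} (Λ : Submodule ℤ (EuclideanSpace ℝ (Fin n))) : ℝ :=
  sInf {r : ℝ | ∃ x ∈ Λ, x ≠ 0 ∧ ⟪x, x⟫ = r}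

/-- The set of minimal vectors of a lattice `Λ`:
`S(Λ) = {x ∈ Λ : x ≠ 0, N(x) = min Λ}`. -/
def minimalVectors {n : ℕ} (Λ : Submodule ℤ (EuclideanSpace ℝ (Fin n))) :
    Set (EuclideanSpace ℝ (Fin n)) :=
  {x | x ∈ Λ ∧ x ≠ 0 ∧ ⟪x, x⟫ = latticeMin Λ}

/-- `Λ` is a (full-rank) lattice in `ℝⁿ`: a discrete subgroup that spans `ℝⁿ`. -/
def IsLattice {n : ℕ} (Λ : Submodule ℤ (EuclideanSpace ℝ (Fin n))) : Prop :=
  DiscreteTopology Λ ∧ Submodule.span ℝ (Λ : Set (EuclideanSpace ℝ (Fin n))) = ⊤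

/-- `Λ'` is a Minkowskian sublattice of `Λ`: it is generated by `n` linearly
independent minimal vectors of `Λ`. -/
def IsMinkowskian {n : ℕ} (Λ Λ' : Submodule ℤ (EuclideanSpace ℝ (Fin n))) : Prop :=
  ∃ e : Fin n → EuclideanSpace ℝ (Fin n),
    LinearIndependent ℝ e ∧ (∀ i, e i ∈ minimalVectors Λ) ∧
      Λ' = Submodule.span ℤ (Set.range e)

/-- The quotient group `Λ/Λ'`. -/
abbrev quotLat {n : ℕ} (Λ Λ' : Submodule ℤ (EuclideanSpace ℝ (Fin n))) : Type :=
  Λ ⧸ (Submodule.comap Λ.subtype Λ')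

/-- The index `[Λ : Λ']`. -/
def subIndex {n : ℕ} (Λ Λ' : Submodule ℤ (EuclideanSpace ℝ (Fin n))) : ℕ :=
  Nat.card (quotLat Λ Λ')

/-- Watson's identity. -/
theorem watson_identity {V ι : Type*} [NormedAddCommGroup V] [InnerProductSpace ℝ V] [Fintype ι]
    {e : ι → V} {a : ι → ℤ} {d : ℤ} {x : V} {m : ℝ} (he : ∀ i, ⟪e i, e i⟫ = m)
    (hx : ∑ i, a i • e i = d • x) :
    ∑ i, |(a i : ℝ)| * (⟪x - (a i).sign • e i, x - (a i).sign • e i⟫ - m) =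
      (∑ i, |(a i : ℝ)| - 2 * d) * ⟪x, x⟫ := by
  have h1 : ∑ i, (a i : ℝ) * ⟪x, e i⟫ = d * ⟪x, x⟫ := by
    have h := congrArg (fun v => ⟪x, v⟫) hx
    simpa only [inner_sum, ← Int.cast_smul_eq_zsmul ℝ, real_inner_smul_right] using h
  have h2 : ∀ i, |(a i : ℝ)| * (⟪x - (a i).sign • e i, x - (a i).sign • e i⟫ - m) =
      |(a i : ℝ)| * ⟪x, x⟫ - 2 * ((a i : ℝ) * ⟪x, e i⟫) := by
    intro i
    have hs : |(a i : ℝ)| * ((a i).sign : ℝ) = a i := by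
      rcases lt_trichotomy (a i) 0 with h | h | h
      · simp [Int.sign_eq_neg_one_of_neg h, abs_of_neg (Int.cast_lt_zero.2 h : (a i : ℝ) < 0)]
      · simp [h]
      · simp [Int.sign_eq_one_of_pos h, abs_of_pos (Int.cast_pos.2 h : 0 < (a i : ℝ))]
    have hs2 : |(a i : ℝ)| * ((a i).sign : ℝ) ^ 2 = |(a i : ℝ)| := by
      rcases lt_trichotomy (a i) 0 with h | h | h
      · simp [Int.sign_eq_neg_one_of_neg h]
      · simp [h]
      · simp [Int.sign_eq_one_of_pos h]
    simp only [← Int.cast_smul_eq_zsmul ℝ, inner_sub_left, inner_sub_right,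
      real_inner_smul_left, real_inner_smul_right, he, real_inner_comm x (e i)]
    linear_combination (-2 * ⟪x, e i⟫) * hs + m * hs2
  rw [Finset.sum_congr rfl fun i _ => h2 i, Finset.sum_sub_distrib, ← Finset.mul_sum,
    ← Finset.sum_mul, h1]
  ring

theorem sub_zsmul_mem_and_notMem {V ι : Type*} [AddCommGroup V] {Λ : Submodule ℤ V} {e : ι → V}
    (heΛ : ∀ i, e i ∈ Λ) {x : V} (hxΛ : x ∈ Λ) (hxe : x ∉ Submodule.span ℤ (Set.range e))
    (k : ℤ) (i : ι) :
    x - k • e i ∈ Λ ∧ x - k • e i ∉ Submodule.span ℤ (Set.range e) := by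
  refine ⟨Λ.sub_mem hxΛ (Λ.smul_mem k (heΛ i)), fun h => hxe ?_⟩
  exact (Submodule.sub_mem_iff_left _
    (Submodule.smul_mem _ k (Submodule.subset_span (Set.mem_range_self i)))).1 h

theorem ne_zero_of_notMem {V : Type*} [AddCommGroup V] {S : Submodule ℤ V} {x : V}
    (hx : x ∉ S) : x ≠ 0 := fun h => hx (h ▸ S.zero_mem)

/-- Watson's inequality: if `d x = ∑ aᵢ eᵢ` with `eᵢ` minimal and `x` not in the sublattice
they generate, then `∑ |aᵢ| ≥ 2 d`. -/
theorem watson_le {V ι : Type*} [NormedAddCommGroup V] [InnerProductSpace ℝ V] [Fintype ι]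
    {Λ : Submodule ℤ V} {e : ι → V} {m : ℝ} (hmin : ∀ v ∈ Λ, v ≠ 0 → m ≤ ⟪v, v⟫)
    (heΛ : ∀ i, e i ∈ Λ) (he : ∀ i, ⟪e i, e i⟫ = m) {a : ι → ℤ} {d : ℤ} {x : V} (hxΛ : x ∈ Λ)
    (hxe : x ∉ Submodule.span ℤ (Set.range e)) (hx : ∑ i, a i • e i = d • x) :
    2 * d ≤ ∑ i, |a i| := by
  have hpos : 0 < ⟪x, x⟫ := real_inner_self_pos.2 (ne_zero_of_notMem hxe)
  have hnn : 0 ≤ (∑ i, |(a i : ℝ)| - 2 * d) * ⟪x, x⟫ := by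
    rw [← watson_identity he hx]
    refine Finset.sum_nonneg fun i _ => mul_nonneg (abs_nonneg _) (sub_nonneg.2 ?_)
    have h := sub_zsmul_mem_and_notMem heΛ hxΛ hxe (a i).sign i
    exact hmin _ h.1 (ne_zero_of_notMem h.2)
  have h := nonneg_of_mul_nonneg_left hnn hpos
  exact_mod_cast sub_nonneg.1 h

/-- The equality case of Watson's inequality. -/
theorem watson_eq {V ι : Type*} [NormedAddCommGroup V] [InnerProductSpace ℝ V] [Fintype ι]
    {Λ : Submodule ℤ V} {e : ι → V} {m : ℝ} (hmin : ∀ v ∈ Λ, v ≠ 0 → m ≤ ⟪v, v⟫)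
    (heΛ : ∀ i, e i ∈ Λ) (he : ∀ i, ⟪e i, e i⟫ = m) {a : ι → ℤ} {d : ℤ} {x : V} (hxΛ : x ∈ Λ)
    (hxe : x ∉ Submodule.span ℤ (Set.range e)) (hx : ∑ i, a i • e i = d • x)
    (hd : ∑ i, |a i| = 2 * d) {i : ι} (hi : a i ≠ 0) :
    ⟪x - (a i).sign • e i, x - (a i).sign • e i⟫ = m := by
  have hd' : ∑ i, |(a i : ℝ)| - 2 * d = 0 := by
    rw [sub_eq_zero]
    exact_mod_cast hd
  have hz := watson_identity he hx
  rw [hd', zero_mul, Finset.sum_eq_zero_iff_of_nonneg] at hz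
  · have h := hz i (Finset.mem_univ i)
    have hne : |(a i : ℝ)| ≠ 0 := abs_ne_zero.2 (Int.cast_ne_zero.2 hi)
    exact sub_eq_zero.1 ((mul_eq_zero.1 h).resolve_left hne)
  · intro i _
    refine mul_nonneg (abs_nonneg _) (sub_nonneg.2 ?_)
    have h := sub_zsmul_mem_and_notMem heΛ hxΛ hxe (a i).sign i
    exact hmin _ h.1 (ne_zero_of_notMem h.2)

/-- In the equality case of Watson's inequality for `d = 2`, the vector is itself minimal. -/
theorem inner_self_eq_of_two_smul_eq {V ι : Type*} [NormedAddCommGroup V] [InnerProductSpace ℝ V]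
    [Fintype ι] {Λ : Submodule ℤ V} {e : ι → V} {m : ℝ}
    (hmin : ∀ v ∈ Λ, v ≠ 0 → m ≤ ⟪v, v⟫) (heΛ : ∀ i, e i ∈ Λ) (he : ∀ i, ⟪e i, e i⟫ = m)
    {a : ι → ℤ} {y : V} (hyΛ : y ∈ Λ) (hye : y ∉ Submodule.span ℤ (Set.range e))
    (hy : ∑ i, a i • e i = (2 : ℤ) • y) (ha : ∀ i, |a i| ≤ 1) (hd : ∑ i, |a i| = 4) :
    ⟪y, y⟫ = m := by
  classical
  obtain ⟨i, hi⟩ : ∃ i, a i ≠ 0 := by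
    by_contra! h
    simp [h] at hd
  have hsgn : (a i).sign = a i := by
    have h := abs_le.1 (ha i)
    have : a i = -1 ∨ a i = 1 := by omega
    rcases this with h | h <;> simp [h]
  have hflip := sub_zsmul_mem_and_notMem heΛ hyΛ hye (a i) i
  have hsum : ∑ j, Function.update a i (-a i) j • e j = (2 : ℤ) • (y - a i • e i) := by
    have h1 : ∀ j, Function.update a i (-a i) j • e j =
        a j • e j - if j = i then (2 : ℤ) • a i • e i else 0 := by
      intro j
      by_cases h : j = i
      · subst h
        simp only [Function.update_self, if_true]
        module
      · simp [h]
    rw [Finset.sum_congr rfl fun j _ => h1 j, Finset.sum_sub_distrib, hy]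
    simp [smul_sub]
  have hd' : ∑ j, |Function.update a i (-a i) j| = 2 * 2 := by
    rw [show (2 * 2 : ℤ) = 4 by norm_num, ← hd]
    refine Finset.sum_congr rfl fun j _ => ?_
    by_cases h : j = i
    · subst h
      simp
    · simp [h]
  have h := watson_eq hmin heΛ he hflip.1 hflip.2 hsum hd' (i := i) (by simpa using hi)
  simpa [hsgn] using h

/-- If `x` has order `4` modulo the sublattice generated by a family of minimal vectors of a
lattice, then the family has at least `7` members. -/
theorem seven_le_card_of_order_four {V ι : Type*} [NormedAddCommGroup V] [InnerProductSpace ℝ V]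
    [Fintype ι] {Λ : Submodule ℤ V} {e : ι → V} {m : ℝ}
    (hmin : ∀ v ∈ Λ, v ≠ 0 → m ≤ ⟪v, v⟫) (heΛ : ∀ i, e i ∈ Λ) (he : ∀ i, ⟪e i, e i⟫ = m)
    (he0 : ∀ i, e i ≠ 0) {x : V} (hxΛ : x ∈ Λ)
    (hx4 : (4 : ℤ) • x ∈ Submodule.span ℤ (Set.range e))
    (hx2 : (2 : ℤ) • x ∉ Submodule.span ℤ (Set.range e)) : 7 ≤ Fintype.card ι := by
  classical
  by_contra! hcard
  obtain ⟨b, hb⟩ := (Submodule.mem_span_range_iff_exists_fun ℤ).1 hx4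
  have hcomb : ∀ c : ι → ℤ, ∑ i, c i • e i ∈ Submodule.span ℤ (Set.range e) := fun c =>
    Submodule.sum_mem _ fun i _ => Submodule.smul_mem _ _
      (Submodule.subset_span (Set.mem_range_self i))
  have hle : Submodule.span ℤ (Set.range e) ≤ Λ :=
    Submodule.span_le.2 (by rintro _ ⟨i, rfl⟩; exact heΛ i)
  obtain ⟨z, hzΛ, hz2, a, ha, haz⟩ : ∃ z ∈ Λ, (2 : ℤ) • z ∉ Submodule.span ℤ (Set.range e) ∧
      ∃ a : ι → ℤ, (∀ i, -2 ≤ a i ∧ a i ≤ 1) ∧ ∑ i, a i • e i = (4 : ℤ) • z := by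
    refine ⟨x - ∑ i, (b i).bdiv 4 • e i, Λ.sub_mem hxΛ (hle (hcomb _)), ?_,
      fun i => (b i).bmod 4, ?_, ?_⟩
    · rw [smul_sub]
      exact fun h => hx2 ((Submodule.sub_mem_iff_left _ (Submodule.smul_mem _ _ (hcomb _))).1 h)
    · intro i
      have h1 := Int.le_bmod (x := b i) (m := 4) (by norm_num)
      have h2 := Int.bmod_lt (x := b i) (m := 4) (by norm_num)
      norm_num at h1 h2
      exact ⟨h1, by omega⟩
    · rw [smul_sub, ← hb, Finset.smul_sum, ← Finset.sum_sub_distrib]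
      refine Finset.sum_congr rfl fun i _ => ?_
      simp only [smul_smul, ← sub_smul, Int.bmod_eq_self_sub_mul_bdiv, Nat.cast_ofNat]
  have hz : z ∉ Submodule.span ℤ (Set.range e) := fun h => hz2 (Submodule.smul_mem _ _ h)
  set c : ι → ℤ := fun i => if a i = -2 then -1 else 0 with hc
  set a' : ι → ℤ := fun i => if a i = -2 then 0 else a i with ha'
  set y : V := (2 : ℤ) • z - ∑ i, c i • e i with hy
  have hyΛ : y ∈ Λ := Λ.sub_mem (Λ.smul_mem _ hzΛ) (hle (hcomb _))
  have hye : y ∉ Submodule.span ℤ (Set.range e) := fun h =>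
    hz2 ((Submodule.sub_mem_iff_left _ (hcomb _)).1 h)
  have hya : ∑ i, a' i • e i = (2 : ℤ) • y := by
    rw [hy, smul_sub, smul_smul, show (2 * 2 : ℤ) = 4 by norm_num, ← haz, Finset.smul_sum,
      ← Finset.sum_sub_distrib]
    refine Finset.sum_congr rfl fun i _ => ?_
    rw [smul_smul, ← sub_smul]
    congr 1
    simp only [ha', hc]
    split_ifs <;> omega
  have hA := watson_le hmin heΛ he hzΛ hz haz
  have hA' := watson_le hmin heΛ he hyΛ hye hya
  have hsum : ∑ i, |a i| + ∑ i, |a' i| ≤ 2 * Fintype.card ι := by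
    rw [← Finset.sum_add_distrib]
    calc ∑ i, (|a i| + |a' i|) ≤ ∑ _i : ι, (2 : ℤ) := Finset.sum_le_sum fun i _ => by
          have := ha i
          simp only [ha']
          split_ifs with h
          · simp [h]
          · have : |a i| ≤ 1 := abs_le.2 (by omega)
            omega
      _ = 2 * Fintype.card ι := by simp [mul_comm]
  have hdiff : ∑ i, |a i| - ∑ i, |a' i| = 2 * (Finset.univ.filter fun i => a i = -2).card := by
    rw [← Finset.sum_sub_distrib, Finset.card_filter]
    push_cast
    rw [Finset.mul_sum]
    refine Finset.sum_congr rfl fun i _ => ?_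
    simp only [ha']
    split_ifs with h <;> simp [h]
  have hcard2 : (Finset.univ.filter fun i => a i = -2).card = 2 := by omega
  obtain ⟨j, k, hjk, hfil⟩ := Finset.card_eq_two.1 hcard2
  have hcsum : ∑ i, c i • e i = -(e j + e k) := by
    simp only [hc, ite_smul, zero_smul]
    rw [← Finset.sum_filter, hfil, Finset.sum_pair hjk]
    module
  have hyy : ⟪y, y⟫ = m := by
    refine inner_self_eq_of_two_smul_eq hmin heΛ he hyΛ hye hya (fun i => ?_) (by omega)
    have := ha i
    simp only [ha']
    split_ifs with h
    · simp
    · exact abs_le.2 (by omega)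
  have hyz : y = z + z + e j + e k := by
    rw [hy, hcsum]
    module
  have hmem : ∀ i, e i ∈ Submodule.span ℤ (Set.range e) := fun i =>
    Submodule.subset_span (Set.mem_range_self i)
  have hge : ∀ w ∈ Submodule.span ℤ (Set.range e), m ≤ ⟪z + w, z + w⟫ := fun w hw =>
    hmin _ (Λ.add_mem hzΛ (hle hw))
      (ne_zero_of_notMem fun h => hz ((Submodule.add_mem_iff_left _ hw).1 h))
  have h0 := hge 0 (Submodule.zero_mem _)
  have h1 := hge _ (hmem j)
  have h2 := hge _ (hmem k)
  have h3 := hge _ (Submodule.add_mem _ (hmem j) (hmem k))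
  have hm : 0 < m := he j ▸ real_inner_self_pos.2 (he0 j)
  rw [hyz] at hyy
  simp only [inner_add_left, inner_add_right, add_zero, he, real_inner_comm z (e j),
    real_inner_comm z (e k), real_inner_comm (e j) (e k)] at hyy h0 h1 h2 h3
  linarith

theorem seven_le_of_minkowskian_cyclic_four {n : ℕ}
    {Λ Λ' : Submodule ℤ (EuclideanSpace ℝ (Fin n))} (hM : IsMinkowskian Λ Λ')
    (f : quotLat Λ Λ' ≃+ ZMod 4) : 7 ≤ n := by
  obtain ⟨e, -, he, rfl⟩ := hM
  obtain ⟨x, hx⟩ := Submodule.Quotient.mk_surjective _ (f.symm 1)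
  have key : ∀ k : ℤ, k • (x : EuclideanSpace ℝ (Fin n)) ∈ Submodule.span ℤ (Set.range e) ↔
      (k : ZMod 4) = 0 := by
    intro k
    have h1 : f (Submodule.Quotient.mk (k • x)) = (k : ZMod 4) := by
      rw [Submodule.Quotient.mk_smul, hx, map_zsmul, AddEquiv.apply_symm_apply, zsmul_one]
    rw [← h1, EmbeddingLike.map_eq_zero_iff, Submodule.Quotient.mk_eq_zero]
    simp
  have hmin : ∀ v ∈ Λ, v ≠ 0 → latticeMin Λ ≤ ⟪v, v⟫ := fun v hv hv0 =>
    csInf_le ⟨0, by rintro _ ⟨w, -, -, rfl⟩; exact real_inner_self_nonneg⟩ ⟨v, hv, hv0, rfl⟩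
  simpa using seven_le_card_of_order_four hmin (fun i => (he i).1) (fun i => (he i).2.2)
    (fun i => (he i).2.1) x.2 ((key 4).2 (by decide)) (fun h => absurd ((key 2).1 h) (by decide))

theorem mem_span_single_iff {n : ℕ} {v : EuclideanSpace ℝ (Fin n)} :
    v ∈ Submodule.span ℤ (Set.range fun i : Fin n => EuclideanSpace.single i (1 : ℝ)) ↔
      ∃ z : Fin n → ℤ, ∀ i, v i = z i := by
  rw [Submodule.mem_span_range_iff_exists_fun]
  refine exists_congr fun z => ?_
  have h : ∀ i, (∑ j, z j • EuclideanSpace.single j (1 : ℝ) : EuclideanSpace ℝ (Fin n)) i = z i := by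
    intro i
    simp [Finset.sum_apply, Pi.single_apply]
  constructor
  · rintro rfl i
    exact h i
  · intro hv
    ext i
    rw [h, hv]

/-- The weights `(1, 1, 1, 1, 2, 2, 2, 0, …, 0)`. -/
def gluingWeight {n : ℕ} (i : Fin n) : ℤ :=
  if (i : ℕ) < 4 then 1 else if (i : ℕ) < 7 then 2 else 0

/-- The vector `(1, 1, 1, 1, 2, 2, 2, 0, …, 0) / 4`. -/
def gluingVector (n : ℕ) : EuclideanSpace ℝ (Fin n) :=
  WithLp.toLp 2 fun i => (gluingWeight i : ℝ) / 4

/-- The lattice generated by `ℤⁿ` and the vector `(1, 1, 1, 1, 2, 2, 2, 0, …, 0) / 4`. -/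
def gluedLattice (n : ℕ) : Submodule ℤ (EuclideanSpace ℝ (Fin n)) :=
  Submodule.span ℤ (Set.range fun i : Fin n => EuclideanSpace.single i (1 : ℝ)) ⊔
    Submodule.span ℤ {gluingVector n}

theorem single_mem_gluedLattice {n : ℕ} (i : Fin n) :
    EuclideanSpace.single i (1 : ℝ) ∈ gluedLattice n :=
  Submodule.mem_sup_left (Submodule.subset_span ⟨i, rfl⟩)

theorem gluingVector_mem_gluedLattice (n : ℕ) : gluingVector n ∈ gluedLattice n :=
  Submodule.mem_sup_right (Submodule.mem_span_singleton_self _)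

theorem exists_int_of_mem_gluedLattice {n : ℕ} {v : EuclideanSpace ℝ (Fin n)}
    (hv : v ∈ gluedLattice n) :
    ∃ (k : ℤ) (z : Fin n → ℤ), ∀ i, 4 * v i = ((k * gluingWeight i + 4 * z i : ℤ) : ℝ) := by
  obtain ⟨u, hu, w, hw, rfl⟩ := Submodule.mem_sup.1 hv
  obtain ⟨z, hz⟩ := mem_span_single_iff.1 hu
  obtain ⟨k, rfl⟩ := Submodule.mem_span_singleton.1 hw
  refine ⟨k, z, fun i => ?_⟩
  simp only [PiLp.add_apply, PiLp.smul_apply, hz, gluingVector, zsmul_eq_mul]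
  push_cast
  ring

theorem sixteen_le_sum_sq {n : ℕ} (hn : 7 ≤ n) (k : ℤ) (z : Fin n → ℤ)
    (h0 : ∃ i, k * gluingWeight i + 4 * z i ≠ 0) :
    16 ≤ ∑ i, (k * gluingWeight i + 4 * z i) ^ 2 := by
  by_cases hk : (4 : ℤ) ∣ k
  · obtain ⟨i, hi⟩ := h0
    obtain ⟨l, rfl⟩ := hk
    refine le_trans ?_ (Finset.single_le_sum
      (f := fun i => (4 * l * gluingWeight i + 4 * z i) ^ 2) (fun j _ => sq_nonneg _)
      (Finset.mem_univ i))
    have hne : l * gluingWeight i + z i ≠ 0 := fun h => hi (by linear_combination 4 * h)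
    have := pow_pos (abs_pos.2 hne) 2
    rw [sq_abs] at this
    linear_combination 16 * Int.add_one_le_iff.2 this
  · obtain ⟨m, rfl⟩ := Nat.exists_eq_add_of_le hn
    rw [Fin.sum_univ_add, Fin.sum_univ_seven]
    have hnn : 0 ≤ ∑ i : Fin m, (k * gluingWeight (Fin.natAdd 7 i) + 4 * z (Fin.natAdd 7 i)) ^ 2 :=
      Finset.sum_nonneg fun i _ => sq_nonneg _
    refine le_add_of_le_of_nonneg ?_ hnn
    have sq_ge : ∀ c a : ℤ, 0 ≤ c → (a ≤ -c ∨ c ≤ a) → c ^ 2 ≤ a ^ 2 := by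
      intro c a hc ha
      rw [sq_le_sq, abs_of_nonneg hc, le_abs]
      omega
    have hw4 : ∀ i : Fin 7, (i : ℕ) < 4 → gluingWeight (Fin.castAdd m i) = 1 := by
      intro i hi
      simp [gluingWeight, hi]
    have hw7 : ∀ i : Fin 7, ¬ (i : ℕ) < 4 → gluingWeight (Fin.castAdd m i) = 2 := by
      intro i hi
      simp [gluingWeight, hi]
    rw [hw4 0 (by decide), hw4 1 (by decide), hw4 2 (by decide), hw4 3 (by decide),
      hw7 4 (by decide), hw7 5 (by decide), hw7 6 (by decide)]
    by_cases hk2 : (2 : ℤ) ∣ k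
    · have h : ∀ a : ℤ, 2 ^ 2 ≤ (k * 1 + 4 * a) ^ 2 := fun a => sq_ge 2 _ (by norm_num) (by omega)
      nlinarith [h (z (Fin.castAdd m 0)), h (z (Fin.castAdd m 1)), h (z (Fin.castAdd m 2)),
        h (z (Fin.castAdd m 3))]
    · have h1 : ∀ a : ℤ, 1 ^ 2 ≤ (k * 1 + 4 * a) ^ 2 := fun a =>
        sq_ge 1 _ (by norm_num) (by omega)
      have h2 : ∀ a : ℤ, 2 ^ 2 ≤ (k * 2 + 4 * a) ^ 2 := fun a =>
        sq_ge 2 _ (by norm_num) (by omega)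
      linarith [h1 (z (Fin.castAdd m 0)), h1 (z (Fin.castAdd m 1)), h1 (z (Fin.castAdd m 2)),
        h1 (z (Fin.castAdd m 3)), h2 (z (Fin.castAdd m 4)), h2 (z (Fin.castAdd m 5)),
        h2 (z (Fin.castAdd m 6))]

theorem one_le_inner_self_of_mem_gluedLattice {n : ℕ} (hn : 7 ≤ n) {v : EuclideanSpace ℝ (Fin n)}
    (hv : v ∈ gluedLattice n) (hv0 : v ≠ 0) : 1 ≤ ⟪v, v⟫ := by
  obtain ⟨k, z, hz⟩ := exists_int_of_mem_gluedLattice hv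
  have h0 : ∃ i, k * gluingWeight i + 4 * z i ≠ 0 := by
    by_contra! h
    refine hv0 (PiLp.ext fun i => ?_)
    have := hz i
    rw [h i] at this
    simpa using this
  have h16 : (16 : ℝ) ≤ ∑ i, (4 * v i) ^ 2 := by
    simp only [hz]
    exact_mod_cast sixteen_le_sum_sq hn k z h0
  have hin : ⟪v, v⟫ = ∑ i, v i ^ 2 := by
    rw [real_inner_self_eq_norm_sq, EuclideanSpace.real_norm_sq_eq]
  simp only [mul_pow, ← Finset.mul_sum, ← hin] at h16
  linarith

theorem latticeMin_gluedLattice {n : ℕ} (hn : 7 ≤ n) : latticeMin (gluedLattice n) = 1 := by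
  refine IsLeast.csInf_eq ⟨⟨EuclideanSpace.single ⟨0, by omega⟩ 1, single_mem_gluedLattice _,
    by simp, by simp⟩, ?_⟩
  rintro _ ⟨v, hv, hv0, rfl⟩
  exact one_le_inner_self_of_mem_gluedLattice hn hv hv0

theorem isLattice_gluedLattice {n : ℕ} (hn : 7 ≤ n) : IsLattice (gluedLattice n) := by
  constructor
  · refine DiscreteTopology.of_forall_le_dist one_pos fun v w hvw => ?_
    have h := one_le_inner_self_of_mem_gluedLattice hn (Submodule.sub_mem _ v.2 w.2)
      (sub_ne_zero.2 fun h => hvw (Subtype.ext h))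
    rw [real_inner_self_eq_norm_sq, one_le_sq_iff₀ (norm_nonneg _)] at h
    change 1 ≤ dist (v : EuclideanSpace ℝ (Fin n)) w
    rwa [dist_eq_norm]
  · rw [eq_top_iff, ← (EuclideanSpace.basisFun (Fin n) ℝ).toBasis.span_eq]
    refine Submodule.span_mono ?_
    rintro _ ⟨i, rfl⟩
    simpa using single_mem_gluedLattice i

theorem isMinkowskian_gluedLattice {n : ℕ} (hn : 7 ≤ n) :
    IsMinkowskian (gluedLattice n)
      (Submodule.span ℤ (Set.range fun i : Fin n => EuclideanSpace.single i (1 : ℝ))) := by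
  refine ⟨_, ?_, fun i => ⟨single_mem_gluedLattice i, by simp, ?_⟩, rfl⟩
  · have h : (fun i : Fin n => EuclideanSpace.single i (1 : ℝ)) =
        (EuclideanSpace.basisFun (Fin n) ℝ).toBasis := by
      ext1 i
      simp
    rw [h]
    exact (EuclideanSpace.basisFun (Fin n) ℝ).toBasis.linearIndependent
  · rw [latticeMin_gluedLattice hn]
    simp

theorem zsmul_gluingVector_mem_iff {n : ℕ} (hn : 7 ≤ n) {k : ℤ} :
    k • gluingVector n ∈
      Submodule.span ℤ (Set.range fun i : Fin n => EuclideanSpace.single i (1 : ℝ)) ↔ 4 ∣ k := by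
  rw [mem_span_single_iff]
  constructor
  · rintro ⟨z, hz⟩
    have h := hz ⟨0, by omega⟩
    simp only [PiLp.smul_apply, gluingVector, gluingWeight, zsmul_eq_mul] at h
    norm_num at h
    refine ⟨z ⟨0, by omega⟩, ?_⟩
    have h' : (k : ℝ) = 4 * z ⟨0, by omega⟩ := by linarith
    exact_mod_cast h'
  · rintro ⟨l, rfl⟩
    refine ⟨fun i => l * gluingWeight i, fun i => ?_⟩
    simp only [PiLp.smul_apply, gluingVector, zsmul_eq_mul]
    push_cast
    ring

theorem nonempty_quotLat_gluedLattice_equiv {n : ℕ} (hn : 7 ≤ n) :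
    Nonempty (quotLat (gluedLattice n)
      (Submodule.span ℤ (Set.range fun i : Fin n => EuclideanSpace.single i (1 : ℝ))) ≃+
        ZMod 4) := by
  set Λ' := Submodule.span ℤ (Set.range fun i : Fin n => EuclideanSpace.single i (1 : ℝ))
  let g : quotLat (gluedLattice n) Λ' :=
    Submodule.Quotient.mk ⟨gluingVector n, gluingVector_mem_gluedLattice n⟩
  let φ : ℤ →+ quotLat (gluedLattice n) Λ' := zmultiplesHom _ g
  have hφ : ∀ k : ℤ, φ k = k • g := fun k => rfl
  have hsurj : Function.Surjective φ := by
    intro q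
    obtain ⟨⟨v, hv⟩, rfl⟩ := Submodule.Quotient.mk_surjective _ q
    obtain ⟨u, hu, w, hw, rfl⟩ := Submodule.mem_sup.1 hv
    obtain ⟨k, rfl⟩ := Submodule.mem_span_singleton.1 hw
    refine ⟨k, ?_⟩
    rw [hφ, ← Submodule.Quotient.mk_smul, Submodule.Quotient.eq, ← Submodule.neg_mem_iff]
    simpa using hu
  have hker : φ.ker = AddSubgroup.zmultiples ((4 : ℕ) : ℤ) := by
    ext k
    rw [AddMonoidHom.mem_ker, hφ, ← Submodule.Quotient.mk_smul, Submodule.Quotient.mk_eq_zero,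
      Int.mem_zmultiples_iff]
    exact zsmul_gluingVector_mem_iff hn
  exact ⟨(QuotientAddGroup.quotientKerEquivOfSurjective φ hsurj).symm.trans
    ((QuotientAddGroup.quotientAddEquivOfEq hker).trans (Int.quotientZMultiplesNatEquivZMod 4))⟩

/-- There exists a lattice `Λ` in `ℝⁿ` possessing a Minkowskian sublattice `Λ'`
with `Λ/Λ'` cyclic of order `4` if and only if `n ≥ 7`. -/
theorem exists_minkowskian_cyclic_four_iff (n : ℕ) :
    (∃ Λ Λ' : Submodule ℤ (EuclideanSpace ℝ (Fin n)),
      IsLattice Λ ∧ IsMinkowskian Λ Λ' ∧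
        Nonempty (quotLat Λ Λ' ≃+ ZMod 4)) ↔ 7 ≤ n := by
  constructor
  · rintro ⟨Λ, Λ', -, hM, ⟨f⟩⟩
    exact seven_le_of_minkowskian_cyclic_four hM f
  · intro hn
    exact ⟨gluedLattice n, _, isLattice_gluedLattice hn, isMinkowskian_gluedLattice hn,
      nonempty_quotLat_gluedLattice_equiv hn⟩
end
end

section
/- There exists a lattice Λ in ℝ^n possessing a Minkowskian sublattice Λ' with Λ/Λ' cyclic of order 5 if and only if n ≥ 8. -/
open scoped BigOperators RealInnerProductSpace

noncomputable section

section LowerBound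

variable {V ι : Type*} [NormedAddCommGroup V] [InnerProductSpace ℝ V]

/-- Watson's inequality: if `5 x` is a sum of vectors of norm `M` with coefficients `1` and `2`,
and all elements of `L` outside `L'` have norm at least `M`, then the coefficients add up to at
least `10`. -/
theorem watson_ten_le {L L' : Submodule ℤ V} (hL : L' ≤ L) {M : ℝ}
    (hM : ∀ v ∈ L, v ∉ L' → M ≤ ⟪v, v⟫) {A B : Finset ι} {e : ι → V} (he : ∀ i, e i ∈ L')
    (heM : ∀ i, ⟪e i, e i⟫ = M) {x : V} (hx : x ∈ L) (hx' : x ∉ L')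
    (h5 : (5 : ℝ) • x = ∑ i ∈ A, e i + (2 : ℝ) • ∑ i ∈ B, e i) :
    10 ≤ A.card + 2 * B.card := by
  have hs : 0 < ⟪x, x⟫ := by
    apply real_inner_self_pos.2
    rintro rfl
    exact hx' L'.zero_mem
  have key : ∀ i, 2 * ⟪x, e i⟫ ≤ ⟪x, x⟫ := fun i => by
    have h := hM (x - e i) (L.sub_mem hx (hL (he i)))
      (fun h => hx' (by simpa using L'.add_mem h (he i)))
    rw [real_inner_sub_sub_self, heM] at h
    linarith
  have sum_le : ∀ S : Finset ι, 2 * ⟪x, ∑ i ∈ S, e i⟫ ≤ S.card * ⟪x, x⟫ := fun S => by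
    rw [inner_sum, Finset.mul_sum, ← nsmul_eq_mul]
    exact Finset.sum_le_card_nsmul S _ _ fun i _ => key i
  have h := congrArg (fun v => ⟪x, v⟫) h5
  simp only [inner_add_right, real_inner_smul_right] at h
  have h2 : (10 : ℝ) * ⟪x, x⟫ ≤ (A.card + 2 * B.card) * ⟪x, x⟫ := by
    linarith [sum_le A, sum_le B]
  exact_mod_cast le_of_mul_le_mul_right h2 hs

/-- If `2 x ∈ L'` and `5 x ∈ L'` then `x ∈ L'`. -/
theorem two_smul_notMem {L' : Submodule ℤ V} {A B : Finset ι} {e : ι → V} (he : ∀ i, e i ∈ L')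
    {x : V} (hx' : x ∉ L') (h5 : (5 : ℝ) • x = ∑ i ∈ A, e i + (2 : ℝ) • ∑ i ∈ B, e i) :
    (2 : ℝ) • x ∉ L' := fun h => hx' <| by
  have hsum : ∀ S : Finset ι, ∑ i ∈ S, e i ∈ L' := fun S => L'.sum_mem fun i _ => he i
  have h5' : (5 : ℝ) • x ∈ L' := by
    rw [h5, two_smul]
    exact L'.add_mem (hsum A) (L'.add_mem (hsum B) (hsum B))
  have : x = (5 : ℝ) • x - ((2 : ℝ) • x + (2 : ℝ) • x) := by module
  rw [this]
  exact L'.sub_mem h5' (L'.add_mem h h)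

/-- There cannot be four coefficients `1` and three coefficients `2`. -/
theorem not_card_four_three {L L' : Submodule ℤ V} (hL : L' ≤ L) {M : ℝ}
    (hM : ∀ v ∈ L, v ∉ L' → M ≤ ⟪v, v⟫) {A B : Finset ι} {e : ι → V} (he : ∀ i, e i ∈ L')
    (heM : ∀ i, ⟪e i, e i⟫ = M) {x : V} (hx : x ∈ L) (hx' : x ∉ L')
    (h5 : (5 : ℝ) • x = ∑ i ∈ A, e i + (2 : ℝ) • ∑ i ∈ B, e i)
    (hA : A.card = 4) (hB : B.card = 3) : False := by
  have hs : 0 < ⟪x, x⟫ := by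
    apply real_inner_self_pos.2
    rintro rfl
    exact hx' L'.zero_mem
  have hf' : ∑ i ∈ B, e i ∈ L' := L'.sum_mem fun i _ => he i
  have hxf : 2 * ⟪x, ∑ i ∈ B, e i⟫ ≤ 3 * ⟪x, x⟫ := by
    rw [inner_sum, Finset.mul_sum]
    have := Finset.sum_le_card_nsmul B (fun i => 2 * ⟪x, e i⟫) ⟪x, x⟫ fun i _ => by
      have h := hM (x - e i) (L.sub_mem hx (hL (he i)))
        (fun h => hx' (by simpa using L'.add_mem h (he i)))
      rw [real_inner_sub_sub_self, heM] at h
      linarith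
    simpa [hB] using this
  generalize hf : ∑ i ∈ B, e i = f at *
  set w : V := (2 : ℝ) • x - f with hw
  have hwL : w ∈ L := by
    rw [hw, two_smul]
    exact L.sub_mem (L.add_mem hx hx) (hL hf')
  have hw' : w ∉ L' := fun h => two_smul_notMem he hx' (hf ▸ h5) <| by
    simpa [hw] using L'.add_mem h hf'
  have hwe : 2 * ⟪w, ∑ i ∈ A, e i⟫ ≤ 4 * ⟪w, w⟫ := by
    rw [inner_sum, Finset.mul_sum]
    have := Finset.sum_le_card_nsmul A (fun i => 2 * ⟪w, e i⟫) ⟪w, w⟫ fun i _ => by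
      have h := hM (w - e i) (L.sub_mem hwL (hL (he i)))
        (fun h => hw' (by simpa using L'.add_mem h (he i)))
      rw [real_inner_sub_sub_self, heM] at h
      linarith
    simpa [hA] using this
  have hg : ∑ i ∈ A, e i = (5 : ℝ) • x - (2 : ℝ) • f := by rw [h5]; abel
  rw [hg, hw] at hwe
  simp only [inner_sub_left, inner_sub_right, real_inner_smul_left, real_inner_smul_right,
    real_inner_comm x f] at hwe
  linarith

/-- At least eight coefficients are nonzero. -/
theorem eight_le_card_add_card [DecidableEq ι] {L L' : Submodule ℤ V} (hL : L' ≤ L) {M : ℝ}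
    (hM : ∀ v ∈ L, v ∉ L' → M ≤ ⟪v, v⟫) {A B : Finset ι} (hAB : Disjoint A B) {e : ι → V}
    (he : ∀ i, e i ∈ L') (heM : ∀ i, ⟪e i, e i⟫ = M) {x : V} (hx : x ∈ L) (hx' : x ∉ L')
    (h5 : (5 : ℝ) • x = ∑ i ∈ A, e i + (2 : ℝ) • ∑ i ∈ B, e i) :
    8 ≤ A.card + B.card := by
  let e' : ι → V := fun i => if i ∈ B then -e i else e i
  have he' : ∀ i, e' i ∈ L' := fun i => by
    by_cases h : i ∈ B <;> simp [e', h, he]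
  have heM' : ∀ i, ⟪e' i, e' i⟫ = M := fun i => by
    rw [← heM i]
    by_cases h : i ∈ B <;> simp [e', h]
  have hf : ∑ i ∈ B, e i ∈ L' := L'.sum_mem fun i _ => he i
  set y : V := (2 : ℝ) • x - ∑ i ∈ B, e i with hy
  have hyL : y ∈ L := by
    rw [hy, two_smul]
    exact L.sub_mem (L.add_mem hx hx) (hL hf)
  have hy' : y ∉ L' := fun h => two_smul_notMem he hx' h5 <| by
    simpa [hy] using L'.add_mem h hf
  have hB' : ∑ i ∈ B, e' i = -∑ i ∈ B, e i := by
    rw [← Finset.sum_neg_distrib]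
    exact Finset.sum_congr rfl fun i hi => by simp [e', hi]
  have hA' : ∑ i ∈ A, e' i = ∑ i ∈ A, e i :=
    Finset.sum_congr rfl fun i hi => by simp [e', Finset.disjoint_left.1 hAB hi]
  have h5' : (5 : ℝ) • y = ∑ i ∈ B, e' i + (2 : ℝ) • ∑ i ∈ A, e' i := by
    rw [hA', hB', hy, smul_sub, smul_comm, h5]
    module
  have h1 := watson_ten_le hL hM he heM hx hx' h5
  have h2 := watson_ten_le hL hM he' heM' hyL hy' h5'
  by_contra! h
  have h3 := not_card_four_three hL hM he heM hx hx' h5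
  have h4 := not_card_four_three hL hM he' heM' hyL hy' h5'
  obtain h | h : A.card = 4 ∧ B.card = 3 ∨ B.card = 4 ∧ A.card = 3 := by omega
  · exact h3 h.1 h.2
  · exact h4 h.1 h.2

end LowerBound

theorem latticeMin_le {n : ℕ} {Λ : Submodule ℤ (EuclideanSpace ℝ (Fin n))}
    {v : EuclideanSpace ℝ (Fin n)} (hv : v ∈ Λ) (h0 : v ≠ 0) : latticeMin Λ ≤ ⟪v, v⟫ :=
  csInf_le ⟨0, by rintro _ ⟨x, -, -, rfl⟩; exact real_inner_self_nonneg⟩ ⟨v, hv, h0, rfl⟩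

theorem eight_le_of_cyclic_five {n : ℕ} {Λ Λ' : Submodule ℤ (EuclideanSpace ℝ (Fin n))}
    (h : IsMinkowskian Λ Λ') (φ : quotLat Λ Λ' ≃+ ZMod 5) : 8 ≤ n := by
  obtain ⟨e, -, hmin, rfl⟩ := h
  set Λ' := Submodule.span ℤ (Set.range e) with hΛ'
  have he : ∀ i, e i ∈ Λ' := fun i => Submodule.subset_span ⟨i, rfl⟩
  have hL : Λ' ≤ Λ := Submodule.span_le.2 <| by rintro _ ⟨i, rfl⟩; exact (hmin i).1
  obtain ⟨x, hx⟩ := Submodule.Quotient.mk_surjective _ (φ.symm 1)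
  have hx' : (x : EuclideanSpace ℝ (Fin n)) ∉ Λ' := fun h => by
    have h0 : Submodule.Quotient.mk x = (0 : quotLat Λ Λ') :=
      (Submodule.Quotient.mk_eq_zero _).2 h
    rw [h0] at hx
    have := congrArg φ hx
    rw [map_zero, AddEquiv.apply_symm_apply] at this
    exact absurd this (by decide)
  have h5 : (5 : ℤ) • (x : EuclideanSpace ℝ (Fin n)) ∈ Λ' := by
    have h0 : Submodule.Quotient.mk ((5 : ℤ) • x) = (0 : quotLat Λ Λ') := by
      rw [Submodule.Quotient.mk_smul, hx, ← map_zsmul]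
      have : (5 : ℤ) • (1 : ZMod 5) = 0 := by decide
      rw [this, map_zero]
    exact (Submodule.Quotient.mk_eq_zero (Λ'.comap Λ.subtype)).1 h0
  obtain ⟨c, hc⟩ := (Submodule.mem_span_range_iff_exists_fun ℤ).1 h5
  let r : Fin n → ℤ := fun i => (c i + 2) % 5 - 2
  have hr : ∀ i, -2 ≤ r i ∧ r i ≤ 2 := fun i => by
    simp only [r]; omega
  let q : Fin n → ℤ := fun i => (c i + 2) / 5
  have hq : ∀ i, c i = 5 * q i + r i := fun i => by
    simp only [q, r]; omega
  set y : EuclideanSpace ℝ (Fin n) := x - ∑ i, q i • e i with hy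
  have hqe : ∑ i, q i • e i ∈ Λ' := Λ'.sum_mem fun i _ => Λ'.smul_mem _ (he i)
  have hyL : y ∈ Λ := Λ.sub_mem x.2 (hL hqe)
  have hy' : y ∉ Λ' := fun h => hx' (by simpa [hy] using Λ'.add_mem h hqe)
  let e' : Fin n → EuclideanSpace ℝ (Fin n) := fun i => if r i < 0 then -e i else e i
  have he' : ∀ i, e' i ∈ Λ' := fun i => by
    by_cases h : r i < 0 <;> simp [e', h, he]
  have heM' : ∀ i, ⟪e' i, e' i⟫ = latticeMin Λ := fun i => by
    rw [← (hmin i).2.2]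
    by_cases h : r i < 0 <;> simp [e', h]
  let A : Finset (Fin n) := Finset.univ.filter fun i => |r i| = 1
  let B : Finset (Fin n) := Finset.univ.filter fun i => |r i| = 2
  have hAB : Disjoint A B := Finset.disjoint_filter.2 fun i _ h => by omega
  have hy5 : (5 : ℝ) • y = ∑ i ∈ A, e' i + (2 : ℝ) • ∑ i ∈ B, e' i := by
    have h1 : (5 : ℝ) • y = ∑ i, r i • e i := by
      have : (5 : ℝ) • y = (5 : ℤ) • y := by rw [← Int.cast_smul_eq_zsmul ℝ]; norm_num
      rw [this, hy, smul_sub, ← hc, Finset.smul_sum, ← Finset.sum_sub_distrib]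
      refine Finset.sum_congr rfl fun i _ => ?_
      rw [hq i]
      module
    rw [h1, Finset.smul_sum, Finset.sum_filter, Finset.sum_filter, ← Finset.sum_add_distrib]
    refine Finset.sum_congr rfl fun i _ => ?_
    have := hr i
    simp only [e', ← Int.cast_smul_eq_zsmul ℝ]
    generalize r i = k at *
    obtain ⟨h1, h2⟩ := this
    interval_cases k <;> simp
  have hM : ∀ v ∈ Λ, v ∉ Λ' → latticeMin Λ ≤ ⟪v, v⟫ := fun v hv hv' =>
    latticeMin_le hv <| by rintro rfl; exact hv' Λ'.zero_mem
  have h8 := eight_le_card_add_card hL hM hAB he' heM' hyL hy' hy5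
  rw [← Finset.card_union_of_disjoint hAB] at h8
  exact h8.trans (card_finset_fin_le _)


section Construction

variable (m : ℕ)

/-- The inclusion of `ℤⁿ` in `ℝⁿ`. -/
def intEmbedding (n : ℕ) : (Fin n → ℤ) →ₗ[ℤ] EuclideanSpace ℝ (Fin n) where
  toFun y := WithLp.toLp 2 fun i => (y i : ℝ)
  map_add' x y := by ext i; simp
  map_smul' c y := by ext i; simp

@[simp]
theorem intEmbedding_apply {n : ℕ} (y : Fin n → ℤ) (i : Fin n) : intEmbedding n y i = y i := rfl

theorem intEmbedding_injective (n : ℕ) : Function.Injective (intEmbedding n) := fun x y h => by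
  ext i
  have := congrArg (fun v : EuclideanSpace ℝ (Fin n) => v i) h
  simpa using this

theorem inner_intEmbedding_self {n : ℕ} (y : Fin n → ℤ) :
    ⟪intEmbedding n y, intEmbedding n y⟫ = ((∑ i, y i ^ 2 : ℤ) : ℝ) := by
  simp [PiLp.inner_apply, pow_two, -inner_self_eq_norm_sq_to_K]

/-- Integral coordinates of `2 (Dₙ ∪ (Dₙ + (1/2, …, 1/2, 0, …, 0)))`, the vector added having
eight nonzero coordinates, for `n = 8 + m`. -/
def evenLattice : Submodule ℤ (Fin (8 + m) → ℤ) where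
  carrier := {y | (∀ i : Fin 8, (2 : ℤ) ∣ y (Fin.castAdd m i) - y (Fin.castAdd m 0)) ∧
    (∀ j : Fin m, (2 : ℤ) ∣ y (Fin.natAdd 8 j)) ∧ (4 : ℤ) ∣ ∑ i, y i}
  zero_mem' := by simp
  add_mem' := by
    rintro x y ⟨hx1, hx2, hx3⟩ ⟨hy1, hy2, hy3⟩
    refine ⟨fun i => ?_, fun j => dvd_add (hx2 j) (hy2 j), ?_⟩
    · simpa only [Pi.add_apply, add_sub_add_comm] using dvd_add (hx1 i) (hy1 i)
    · simpa only [Pi.add_apply, Finset.sum_add_distrib] using dvd_add hx3 hy3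
  smul_mem' := by
    rintro c x ⟨hx1, hx2, hx3⟩
    refine ⟨fun i => ?_, fun j => (hx2 j).mul_left c, ?_⟩
    · simpa only [Pi.smul_apply, smul_eq_mul, mul_sub] using (hx1 i).mul_left c
    · simpa only [Pi.smul_apply, smul_eq_mul, Finset.mul_sum] using hx3.mul_left c

variable {m} in
theorem mem_evenLattice {y : Fin (8 + m) → ℤ} : y ∈ evenLattice m ↔
    (∀ i : Fin 8, (2 : ℤ) ∣ y (Fin.castAdd m i) - y (Fin.castAdd m 0)) ∧
    (∀ j : Fin m, (2 : ℤ) ∣ y (Fin.natAdd 8 j)) ∧ (4 : ℤ) ∣ ∑ i, y i := Iff.rfl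

variable {m} in
theorem eight_le_sum_sq {y : Fin (8 + m) → ℤ} (hy : y ∈ evenLattice m) (h0 : y ≠ 0) :
    8 ≤ ∑ i, y i ^ 2 := by
  obtain ⟨h1, h2, h3⟩ := hy
  by_cases hp : (2 : ℤ) ∣ y (Fin.castAdd m 0)
  · have h2y : ∀ i, (2 : ℤ) ∣ y i := fun i => by
      refine Fin.addCases (fun i => ?_) h2 i
      exact (dvd_sub_left hp).1 (h1 i)
    choose w hw using h2y
    obtain rfl : y = fun i => 2 * w i := funext hw
    have hsum : (2 : ℤ) ∣ ∑ i, w i ^ 2 := by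
      rw [← Finset.mul_sum] at h3
      have h4 : (2 : ℤ) ∣ ∑ i, w i := by omega
      have h5 : (2 : ℤ) ∣ ∑ i, (w i ^ 2 - w i) := Finset.dvd_sum fun i _ => by
        have := Int.even_mul_pred_self (w i)
        rw [show w i ^ 2 - w i = w i * (w i - 1) by ring]
        exact this.two_dvd
      rw [Finset.sum_sub_distrib] at h5
      exact (dvd_sub_left h4).1 h5
    have hpos : 0 < ∑ i, w i ^ 2 := by
      obtain ⟨i, hi⟩ := Function.ne_iff.1 h0
      refine Finset.sum_pos' (fun i _ => sq_nonneg _) ⟨i, Finset.mem_univ _, ?_⟩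
      have : w i ≠ 0 := by rintro h; simp [h] at hi
      positivity
    simp only [mul_pow, ← Finset.mul_sum]
    omega
  · rw [Fin.sum_univ_add]
    have ha : ∑ i : Fin 8, (1 : ℤ) ≤ ∑ i : Fin 8, y (Fin.castAdd m i) ^ 2 :=
      Finset.sum_le_sum fun i _ => by
        have : y (Fin.castAdd m i) ≠ 0 := fun h => hp (by simpa [h] using h1 i)
        have : 0 < y (Fin.castAdd m i) ^ 2 := by positivity
        omega
    have hb : 0 ≤ ∑ j : Fin m, y (Fin.natAdd 8 j) ^ 2 := Finset.sum_nonneg fun _ _ => sq_nonneg _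
    simp at ha
    omega

/-- Twice a basis of roots of `A₄ ⊕ A₄` in `E₈`. -/
def rootMatrix : Fin 8 → Fin 8 → ℤ :=
  ![![2, -2, 0, 0, 0, 0, 0, 0],
    ![0, 2, -2, 0, 0, 0, 0, 0],
    ![0, 0, 2, -2, 0, 0, 0, 0],
    ![0, 0, 0, 2, -2, 0, 0, 0],
    ![1, 1, 1, 1, 1, -1, -1, 1],
    ![0, 0, 0, 0, 0, 2, -2, 0],
    ![0, 0, 0, 0, 0, 0, 2, -2],
    ![0, 0, 0, 0, 0, 0, 2, 2]]

/-- The independent minimal vectors generating the sublattice of index `5`. -/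
def minVec : Fin (8 + m) → Fin (8 + m) → ℤ :=
  Fin.addCases (fun i => Fin.append (rootMatrix i) 0)
    (fun j => Fin.append ![0, 0, 0, 0, 0, 0, 0, 2] (Pi.single j 2))

theorem minVec_mem (i : Fin (8 + m)) : minVec m i ∈ evenLattice m := by
  rw [mem_evenLattice]
  refine Fin.addCases (fun i => ?_) (fun j => ?_) i
  · simp only [minVec, Fin.addCases_left, Fin.append_left, Fin.append_right, Fin.sum_univ_add]
    refine ⟨?_, by simp, ?_⟩
    · revert i; decide
    · simp only [Pi.zero_apply, Finset.sum_const_zero, add_zero]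
      revert i; decide
  · simp only [minVec, Fin.addCases_right, Fin.append_left, Fin.append_right, Fin.sum_univ_add]
    refine ⟨by decide, fun k => ?_, ?_⟩
    · by_cases h : k = j <;> simp [h]
    · simp [Fin.sum_univ_eight]

theorem sum_sq_minVec (i : Fin (8 + m)) : ∑ k, minVec m i k ^ 2 = 8 := by
  refine Fin.addCases (fun i => ?_) (fun j => ?_) i
  · simp only [minVec, Fin.addCases_left, Fin.append_left, Fin.append_right, Fin.sum_univ_add]
    simp only [Pi.zero_apply, ne_eq, OfNat.ofNat_ne_zero, not_false_eq_true, zero_pow,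
      Finset.sum_const_zero, add_zero]
    revert i; decide
  · simp only [minVec, Fin.addCases_right, Fin.append_left, Fin.append_right, Fin.sum_univ_add]
    simp [Fin.sum_univ_eight, Pi.single_apply, ite_pow]

variable {m}

theorem sum_smul_minVec_castAdd {R : Type*} [CommRing R] (g : Fin (8 + m) → R) (k : Fin 8) :
    ∑ i, g i * (minVec m i (Fin.castAdd m k) : R) =
      ∑ i : Fin 8, g (Fin.castAdd m i) * (rootMatrix i k : R) +
        (∑ j : Fin m, g (Fin.natAdd 8 j)) * if k = 7 then 2 else 0 := by
  rw [Fin.sum_univ_add, Finset.sum_mul]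
  simp only [minVec, Fin.addCases_left, Fin.addCases_right, Fin.append_left]
  congr 1
  refine Finset.sum_congr rfl fun j _ => ?_
  congr 1
  fin_cases k <;> simp

theorem sum_smul_minVec_natAdd {R : Type*} [CommRing R] (g : Fin (8 + m) → R) (j : Fin m) :
    ∑ i, g i * (minVec m i (Fin.natAdd 8 j) : R) = 2 * g (Fin.natAdd 8 j) := by
  rw [Fin.sum_univ_add]
  simp [minVec, Pi.single_apply, mul_comm]

theorem linearIndependent_minVec :
    LinearIndependent ℝ fun i => intEmbedding (8 + m) (minVec m i) := by
  rw [Fintype.linearIndependent_iff]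
  intro g hg
  have hk : ∀ k, ∑ i, g i * (minVec m i k : ℝ) = 0 := fun k => by
    have := congrArg (fun v : EuclideanSpace ℝ (Fin (8 + m)) => v k) hg
    simpa using this
  have hr : ∀ j : Fin m, g (Fin.natAdd 8 j) = 0 := fun j => by
    have := hk (Fin.natAdd 8 j)
    rw [sum_smul_minVec_natAdd] at this
    linarith
  have hl : ∀ k : Fin 8, ∑ i : Fin 8, g (Fin.castAdd m i) * (rootMatrix i k : ℝ) = 0 :=
    fun k => by
      have := hk (Fin.castAdd m k)
      rw [sum_smul_minVec_castAdd] at this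
      simpa [hr] using this
  refine fun i => Fin.addCases (fun i => ?_) hr i
  simp only [Fin.forall_fin_succ, Fin.sum_univ_eight, rootMatrix] at hl
  simp at hl
  obtain ⟨h0, h1, h2, h3, h4, h5, h6, h7⟩ := hl
  fin_cases i <;> simp <;> linarith

/-- Solution of the linear system expressing a vector in terms of the rows of `rootMatrix`. -/
theorem exists_sum_mul_rootMatrix (z : Fin 8 → ℤ) (s : ℤ) (hz : ∀ i, (2 : ℤ) ∣ z i - z 0)
    (hsum : (4 : ℤ) ∣ z 0 + z 1 + z 2 + z 3 + z 4 + z 5 + z 6 + z 7 + 2 * s)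
    (h5 : (5 : ℤ) ∣ z 0 + z 1 + z 2 + z 3 + z 4) :
    ∃ a : Fin 8 → ℤ, ∀ k,
      ∑ i, a i * rootMatrix i k + s * (if k = 7 then 2 else 0) = z k := by
  obtain ⟨t, ht⟩ := h5
  obtain ⟨a₀, h₀⟩ : (2 : ℤ) ∣ z 0 - t := by
    have := hz 1; have := hz 2; have := hz 3; have := hz 4; omega
  obtain ⟨a₁, h₁⟩ : (2 : ℤ) ∣ z 1 - t + 2 * a₀ := by have := hz 1; omega
  obtain ⟨a₂, h₂⟩ : (2 : ℤ) ∣ z 2 - t + 2 * a₁ := by have := hz 2; omega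
  obtain ⟨a₃, h₃⟩ : (2 : ℤ) ∣ z 3 - t + 2 * a₂ := by have := hz 3; omega
  obtain ⟨a₅, h₅⟩ : (2 : ℤ) ∣ z 5 + t := by have := hz 5; omega
  obtain ⟨a₇, h₇⟩ : (4 : ℤ) ∣ z 5 + z 6 + z 7 + t - 2 * s := by omega
  obtain ⟨a₆, h₆⟩ : (2 : ℤ) ∣ z 6 + t + 2 * a₅ - 2 * a₇ := by have := hz 6; omega
  refine ⟨![a₀, a₁, a₂, a₃, t, a₅, a₆, a₇], fun k => ?_⟩
  clear hz hsum
  fin_cases k <;> simp [Fin.sum_univ_eight, rootMatrix] <;> linarith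

theorem mem_span_minVec {y : Fin (8 + m) → ℤ} (hy : y ∈ evenLattice m)
    (h5 : (5 : ℤ) ∣ ∑ i : Fin 5, y (Fin.castAdd m (Fin.castLE (by norm_num) i))) :
    y ∈ Submodule.span ℤ (Set.range (minVec m)) := by
  obtain ⟨h1, h2, h3⟩ := hy
  choose u hu using h2
  rw [Fin.sum_univ_add] at h3
  simp only [hu, ← Finset.mul_sum] at h3
  rw [Fin.sum_univ_eight] at h3
  rw [Fin.sum_univ_five] at h5
  rw [Submodule.mem_span_range_iff_exists_fun]
  obtain ⟨a, ha⟩ := exists_sum_mul_rootMatrix (fun i => y (Fin.castAdd m i)) (∑ j, u j) h1 h3 h5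
  refine ⟨Fin.addCases a u, ?_⟩
  ext k
  simp only [Finset.sum_apply, Pi.smul_apply, smul_eq_mul]
  refine Fin.addCases (fun k => ?_) (fun j => ?_) k
  · have := sum_smul_minVec_castAdd (Fin.addCases a u) k
    simp only [Int.cast_id, Fin.addCases_left, Fin.addCases_right] at this
    rw [this, ha]
  · have := sum_smul_minVec_natAdd (Fin.addCases a u) j
    simp only [Int.cast_id, Fin.addCases_right] at this
    rw [this, hu]

variable (m)

/-- The sum of the first five coordinates modulo `5`. -/
def sumFive : (Fin (8 + m) → ℤ) →ₗ[ℤ] ZMod 5 where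
  toFun y := ((∑ i : Fin 5, y (Fin.castAdd m (Fin.castLE (by norm_num) i)) : ℤ) : ZMod 5)
  map_add' x y := by simp [Finset.sum_add_distrib]
  map_smul' c y := by simp [Finset.mul_sum]

theorem sumFive_minVec (i : Fin (8 + m)) : sumFive m (minVec m i) = 0 := by
  change ((∑ i : Fin 5, _ : ℤ) : ZMod 5) = 0
  refine Fin.addCases (fun i => ?_) (fun j => ?_) i
  · simp only [minVec, Fin.addCases_left, Fin.append_left]
    revert i; decide
  · simp only [minVec, Fin.addCases_right, Fin.append_left]
    decide

theorem exists_lattice_eight_add :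
    ∃ Λ Λ' : Submodule ℤ (EuclideanSpace ℝ (Fin (8 + m))),
      IsLattice Λ ∧ IsMinkowskian Λ Λ' ∧ Nonempty (quotLat Λ Λ' ≃+ ZMod 5) := by
  set ι := intEmbedding (8 + m) with hι
  have hinj : Function.Injective ι := intEmbedding_injective _
  set Λ := (evenLattice m).map ι with hΛ
  set e := fun i => ι (minVec m i) with he
  have heΛ : ∀ i, e i ∈ Λ := fun i => ⟨_, minVec_mem m i, rfl⟩
  have hli : LinearIndependent ℝ e := linearIndependent_minVec
  have he8 : ∀ i, ⟪e i, e i⟫ = 8 := fun i => by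
    rw [he, inner_intEmbedding_self, sum_sq_minVec]
    norm_num
  have hmin : latticeMin Λ = 8 := by
    refine IsLeast.csInf_eq ⟨⟨e 0, heΛ 0, hli.ne_zero 0, he8 0⟩, ?_⟩
    rintro _ ⟨_, ⟨y, hy, rfl⟩, h0, rfl⟩
    rw [inner_intEmbedding_self]
    exact_mod_cast eight_le_sum_sq hy (by rintro rfl; exact h0 (map_zero _))
  have hspan : Submodule.span ℤ (Set.range e) = (Submodule.span ℤ (Set.range (minVec m))).map ι := by
    rw [Submodule.map_span, ← Set.range_comp]
    rfl
  refine ⟨Λ, Submodule.span ℤ (Set.range e), ⟨?_, ?_⟩,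
    ⟨e, hli, fun i => ⟨heΛ i, hli.ne_zero i, by rw [he8, hmin]⟩, rfl⟩, ?_⟩
  · have hle : (Λ : Set (EuclideanSpace ℝ (Fin (8 + m)))) ⊆ Submodule.span ℤ
        (Set.range (EuclideanSpace.basisFun (Fin (8 + m)) ℝ).toBasis) := by
      rintro _ ⟨y, -, rfl⟩
      refine (Submodule.mem_span_range_iff_exists_fun ℤ).2 ⟨y, ?_⟩
      ext k
      simp [hι, Pi.single_apply]
    exact DiscreteTopology.of_subset
      (inferInstanceAs (DiscreteTopology (Submodule.span ℤ
        (Set.range (EuclideanSpace.basisFun (Fin (8 + m)) ℝ).toBasis)))) hle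
  · refine top_unique ?_
    rw [← hli.span_eq_top_of_card_eq_finrank' (by simp)]
    refine Submodule.span_mono ?_
    rintro _ ⟨i, rfl⟩
    exact heΛ i
  · let E : evenLattice m ≃ₗ[ℤ] Λ := Submodule.equivMapOfInjective ι hinj _
    let f : Λ →ₗ[ℤ] ZMod 5 := (sumFive m ∘ₗ (evenLattice m).subtype) ∘ₗ E.symm.toLinearMap
    have hf : Function.Surjective f := fun c => by
      let w : Fin (8 + m) → ℤ := Fin.append ![2, 0, 0, 0, 0, 2, 0, 0] 0
      have hw : w ∈ evenLattice m := by
        refine mem_evenLattice.2 ⟨?_, by simp [w], ?_⟩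
        · simp only [w, Fin.append_left]
          decide
        · simp [w, Fin.sum_univ_add, Fin.sum_univ_eight]
      have h2 : f (E ⟨w, hw⟩) = 2 := by
        simp only [f, LinearMap.comp_apply, LinearEquiv.coe_coe, LinearEquiv.symm_apply_apply,
          Submodule.subtype_apply]
        change ((∑ i : Fin 5, _ : ℤ) : ZMod 5) = 2
        simp only [w, Fin.append_left]
        decide
      refine ⟨(3 * c.val : ℤ) • E ⟨w, hw⟩, ?_⟩
      rw [map_smul, h2]
      revert c; decide
    have hker : LinearMap.ker f = (Submodule.span ℤ (Set.range e)).comap Λ.subtype := by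
      ext v
      obtain ⟨y, rfl⟩ := E.surjective v
      have hE : (E y : EuclideanSpace ℝ (Fin (8 + m))) = ι y := rfl
      rw [LinearMap.mem_ker, Submodule.mem_comap, Submodule.subtype_apply, hE, hspan,
        ← Submodule.mem_comap, Submodule.comap_map_eq_of_injective hinj]
      simp only [f, LinearMap.comp_apply, LinearEquiv.coe_coe, LinearEquiv.symm_apply_apply,
        Submodule.subtype_apply]
      constructor
      · intro h
        exact mem_span_minVec y.2 ((ZMod.intCast_zmod_eq_zero_iff_dvd _ 5).1 h)
      · intro h
        refine (Submodule.span_le (p := LinearMap.ker (sumFive m))).2 ?_ h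
        rintro _ ⟨i, rfl⟩
        exact sumFive_minVec m i
    exact ⟨((Submodule.quotEquivOfEq _ _ hker.symm).trans
      (f.quotKerEquivOfSurjective hf)).toAddEquiv⟩

end Construction

/-- There exists a lattice `Λ` in `ℝⁿ` possessing a Minkowskian sublattice `Λ'`
with `Λ/Λ'` cyclic of order `5` if and only if `n ≥ 8`. -/
theorem exists_minkowskian_cyclic_five_iff (n : ℕ) :
    (∃ Λ Λ' : Submodule ℤ (EuclideanSpace ℝ (Fin n)),
      IsLattice Λ ∧ IsMinkowskian Λ Λ' ∧
        Nonempty (quotLat Λ Λ' ≃+ ZMod 5)) ↔ 8 ≤ n := by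
  constructor
  · rintro ⟨Λ, Λ', -, h, ⟨φ⟩⟩
    exact eight_le_of_cyclic_five h φ
  · intro h
    obtain ⟨m, rfl⟩ := Nat.exists_eq_add_of_le h
    exact exists_lattice_eight_add m
end
end
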